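/- Suppose ξ and η are 𝒜-linear maps a⊗𝒜 → b⊗𝒜 with images contained in b⊗m, both satisfying the standard-deformation equation, and let δ be an 𝒜-linear derivation of the Lie algebra l⊗𝒜 with image contained in l⊗m (so δ is nilpotent and exp(δ) := Σ_{k≥0} δ^k/k! is defined). Let Π_A := pr_a∘exp(δ)∘I_ξ : a⊗𝒜 → a⊗𝒜. Then Π_A is bijective, and the following are equivalent: (i) η = −Σ_{k≥0} (1/k!)·e^k (i.e., η is gauge-equivalent to ξ via δ, η = e^δ ∗ ξ); (ii) exp(δ)∘I_ξ = I_η∘Π_A (i.e., the standard deformations I_ξ and I_η are weakly isomorphic via the small automorphism exp(δ)). (This is Proposition 'gauge equivalence vs. weak isomorphism' of the paper, for a Lie pair over a point.) -/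

import Mathlib

open TensorProduct

noncomputable section

/-- The evaluation map id_V ⊗ ev : 𝒜 ⊗[K] V → V induced by ev : 𝒜 → K. -/
def evMap (K 𝒜 : Type) [Field K] [CommRing 𝒜] [Algebra K 𝒜]
    (ev : 𝒜 →ₐ[K] K) (V : Type) [AddCommGroup V] [Module K V] :
    𝒜 ⊗[K] V →ₗ[K] V :=
  (TensorProduct.lid K V).toLinearMap ∘ₗ LinearMap.rTensor V ev.toLinearMap

variable {K : Type} [Field K]
  {l : Type} [LieRing l] [LieAlgebra K l]
  {a : Type} [LieRing a] [LieAlgebra K a]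
  {b : Type} [AddCommGroup b] [Module K b]

/-- The map I_ξ := i + j∘ξ : a⊗𝒜 → l⊗𝒜. -/
def IxiMap (𝒜 : Type) [CommRing 𝒜] [Algebra K 𝒜]
    (i : a →ₗ⁅K⁆ l) (j : b →ₗ[K] l)
    (ξ : 𝒜 ⊗[K] a →ₗ[𝒜] 𝒜 ⊗[K] b) : 𝒜 ⊗[K] a →ₗ[𝒜] 𝒜 ⊗[K] l :=
  LinearMap.baseChange 𝒜 i.toLinearMap + (LinearMap.baseChange 𝒜 j) ∘ₗ ξ

/-- The standard-deformation equation for ξ: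
I_ξ(pr_a [I_ξ x, I_ξ y]) = [I_ξ x, I_ξ y] for all x, y ∈ a⊗𝒜. -/
def StdEq (𝒜 : Type) [CommRing 𝒜] [Algebra K 𝒜]
    (i : a →ₗ⁅K⁆ l) (j : b →ₗ[K] l) (prA : l →ₗ[K] a)
    (ξ : 𝒜 ⊗[K] a →ₗ[𝒜] 𝒜 ⊗[K] b) : Prop :=
  ∀ x y : 𝒜 ⊗[K] a,
    IxiMap 𝒜 i j ξ ((LinearMap.baseChange 𝒜 prA) ⁅IxiMap 𝒜 i j ξ x, IxiMap 𝒜 i j ξ y⁆)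
      = ⁅IxiMap 𝒜 i j ξ x, IxiMap 𝒜 i j ξ y⁆

/-- Truncated exponential Σ_{k<N} δ^k/k! of an 𝒜-linear endomorphism. -/
def expEnd (K : Type) [Field K] {𝒜 : Type} [CommRing 𝒜] [Algebra K 𝒜]
    {M : Type} [AddCommGroup M] [Module 𝒜 M] (N : ℕ) (δ : Module.End 𝒜 M) :
    Module.End 𝒜 M :=
  ∑ k ∈ Finset.range N, (algebraMap K 𝒜 ((k.factorial : K)⁻¹)) • δ ^ k

/-- The binary operation [δ,X]₂ := pr_b∘δ∘j∘X − X∘pr_a∘δ∘i. -/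
def br2 (𝒜 : Type) [CommRing 𝒜] [Algebra K 𝒜]
    (i : a →ₗ⁅K⁆ l) (j : b →ₗ[K] l) (prA : l →ₗ[K] a) (prB : l →ₗ[K] b)
    (δ : Module.End 𝒜 (𝒜 ⊗[K] l)) (X : 𝒜 ⊗[K] a →ₗ[𝒜] 𝒜 ⊗[K] b) :
    𝒜 ⊗[K] a →ₗ[𝒜] 𝒜 ⊗[K] b :=
  (LinearMap.baseChange 𝒜 prB) ∘ₗ δ ∘ₗ (LinearMap.baseChange 𝒜 j) ∘ₗ X
    - X ∘ₗ (LinearMap.baseChange 𝒜 prA) ∘ₗ δ ∘ₗ (LinearMap.baseChange 𝒜 i.toLinearMap)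

/-- The ternary operation [δ,X,Y]₃ := Y∘pr_a∘δ∘j∘X + X∘pr_a∘δ∘j∘Y. -/
def br3 (𝒜 : Type) [CommRing 𝒜] [Algebra K 𝒜]
    (j : b →ₗ[K] l) (prA : l →ₗ[K] a)
    (δ : Module.End 𝒜 (𝒜 ⊗[K] l)) (X Y : 𝒜 ⊗[K] a →ₗ[𝒜] 𝒜 ⊗[K] b) :
    𝒜 ⊗[K] a →ₗ[𝒜] 𝒜 ⊗[K] b :=
  Y ∘ₗ (LinearMap.baseChange 𝒜 prA) ∘ₗ δ ∘ₗ (LinearMap.baseChange 𝒜 j) ∘ₗ X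
    + X ∘ₗ (LinearMap.baseChange 𝒜 prA) ∘ₗ δ ∘ₗ (LinearMap.baseChange 𝒜 j) ∘ₗ Y

section RiccatiPolynomials

open Polynomial

/-- A polynomial solution of `f' = s * f` with zero constant coefficient vanishes. -/
theorem Polynomial.eq_zero_of_derivative_eq_mul {R : Type*} [Ring R] [IsAddTorsionFree R]
    {f s : R[X]} (h : derivative f = s * f) (h0 : f.coeff 0 = 0) : f = 0 := by
  ext k
  induction k using Nat.strong_induction_on with
  | _ k ih =>
    cases k with
    | zero => simpa using h0
    | succ k =>
      have hk : (derivative f).coeff k = 0 := by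
        rw [h, coeff_mul]
        refine Finset.sum_eq_zero fun x hx => ?_
        have hx' : x.1 + x.2 = k := by simpa using hx
        rw [ih x.2 (by omega), coeff_zero, mul_zero]
      rw [coeff_derivative, ← Nat.cast_succ, ← nsmul_eq_mul'] at hk
      exact (smul_eq_zero_iff_right k.succ_ne_zero).mp hk

/-- If `x` solves the Riccati recursion for `(q - x) * δ * (p + x)` and `u` solves the linear
recursion `u' = δ * u`, both with finitely many nonzero terms, then `q * ∑ u = ∑ x * ∑ u`
as soon as this holds for the initial terms. -/
theorem riccati_sum_mul_sum_eq_zero {R : Type*} [Ring R] [IsAddTorsionFree R]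
    {p q δ : R} (hpq : p + q = 1) {x u : ℕ → R} {n : ℕ}
    (hx : ∀ k, n ≤ k → x k = 0) (hu : ∀ k, n ≤ k → u k = 0)
    (hx' : ∀ k, (k + 1) • x (k + 1) = (if k = 0 then q * δ * p else 0) + q * δ * x k
      - x k * δ * p - ∑ s ∈ Finset.HasAntidiagonal.antidiagonal k, x s.1 * δ * x s.2)
    (hu' : ∀ k, (k + 1) • u (k + 1) = δ * u k)
    (h0 : (q - x 0) * u 0 = 0) :
    (q - ∑ k ∈ Finset.range n, x k) * ∑ k ∈ Finset.range n, u k = 0 := by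
  have coeff_sum : ∀ y : ℕ → R, (∀ k, n ≤ k → y k = 0) → ∀ k,
      (∑ m ∈ Finset.range n, monomial m (y m)).coeff k = y k := by
    intro y hy k
    simp only [finsetSum_coeff, coeff_monomial, Finset.sum_ite_eq', Finset.mem_range]
    split_ifs with h
    · rfl
    · exact (hy k (not_lt.mp h)).symm
  set F : R[X] := ∑ m ∈ Finset.range n, monomial m (x m) with hF
  set G : R[X] := ∑ m ∈ Finset.range n, monomial m (u m) with hG
  have hFc : ∀ k, F.coeff k = x k := coeff_sum x hx
  have hGc : ∀ k, G.coeff k = u k := coeff_sum u hu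
  have hF' : derivative F = (C q - F) * C δ * (C p + F) := by
    have hexp : (C q - F) * C δ * (C p + F)
        = C (q * δ * p) + C (q * δ) * F - F * C (δ * p) - F * C δ * F := by
      simp only [C_mul]; noncomm_ring
    ext k
    rw [hexp, coeff_derivative, ← Nat.cast_succ, ← nsmul_eq_mul', hFc, hx']
    rw [coeff_sub, coeff_mul (F * C δ)]
    simp only [coeff_add, coeff_sub, coeff_C, coeff_C_mul, coeff_mul_C, hFc, mul_assoc]
  have hG' : derivative G = C δ * G := by
    ext k
    rw [coeff_derivative, ← Nat.cast_succ, ← nsmul_eq_mul', hGc, hu', coeff_C_mul, hGc]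
  have hp : (C p : R[X]) = 1 - C q := by rw [← C_1, ← hpq, C_add, add_sub_cancel_right]
  have key : (C q - F) * G = 0 := by
    refine eq_zero_of_derivative_eq_mul (s := (C q - F) * C δ) ?_ ?_
    · rw [derivative_mul, derivative_sub, derivative_C, hF', hG', hp]
      noncomm_ring
    · simpa [mul_coeff_zero, hFc, hGc] using h0
  have heval := congrArg (eval₂ (RingHom.id R) 1) key
  rw [eval₂_mul_noncomm _ _ (fun k => Commute.one_right _)] at heval
  simpa [hF, hG, eval₂_finsetSum, eval₂_sub] using heval

end RiccatiPolynomials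

theorem Finset.sum_antidiagonal_eq_ends_add_Ioo {R : Type*} [AddCommMonoid R] (f : ℕ → ℕ → R)
    {k : ℕ} (hk : 1 ≤ k) :
    ∑ s ∈ Finset.HasAntidiagonal.antidiagonal k, f s.1 s.2
      = f 0 k + f k 0 + ∑ m ∈ Finset.Ioo 0 k, f m (k - m) := by
  obtain ⟨k, rfl⟩ := Nat.exists_eq_add_of_le' hk
  have hIoo : Finset.Ioo 0 (k + 1) = Finset.Ico 1 (k + 1) := by ext; simp; omega
  rw [Finset.Nat.sum_antidiagonal_eq_sum_range_succ (fun i j => f i j), Finset.sum_range_succ,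
    Finset.range_eq_Ico, Finset.sum_eq_sum_Ico_succ_bot (Nat.succ_pos k), hIoo]
  simp only [Nat.sub_zero, Nat.sub_self, zero_add]
  abel

/-- Rescaling the gauge recursion by `-1 / k!` turns it into the Riccati recursion. -/
theorem riccati_of_gauge_recursion {F R : Type*} [Field F] [CharZero F] [Ring R] [Algebra F R]
    {p q δ x₀ : R} {ε : ℕ → R} (h0 : ε 0 = -x₀)
    (h1 : ε 1 = -((q - x₀) * δ * (p + x₀)))
    (hε : ∀ k, 1 ≤ k → ε (k + 1) = q * δ * ε k - ε k * δ * p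
      - (ε k * δ * x₀ + x₀ * δ * ε k)
      + (2 : F)⁻¹ • ∑ m ∈ Finset.Ioo 0 k,
          ((k.factorial : F) / ((m.factorial : F) * ((k - m).factorial : F))) •
            (ε (k - m) * δ * ε m + ε m * δ * ε (k - m)))
    (k : ℕ) :
    (k + 1) • (-((k + 1).factorial : F)⁻¹ • ε (k + 1)) =
      (if k = 0 then q * δ * p else 0) + q * δ * (-(k.factorial : F)⁻¹ • ε k)
      - (-(k.factorial : F)⁻¹ • ε k) * δ * p
      - ∑ s ∈ Finset.HasAntidiagonal.antidiagonal k,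
          (-(s.1.factorial : F)⁻¹ • ε s.1) * δ * (-(s.2.factorial : F)⁻¹ • ε s.2) := by
  have hfac : ∀ m : ℕ, (m.factorial : F) ≠ 0 := fun m => by exact_mod_cast m.factorial_ne_zero
  have hscale : (k + 1) • (-((k + 1).factorial : F)⁻¹ • ε (k + 1))
      = -(k.factorial : F)⁻¹ • ε (k + 1) := by
    rw [← Nat.cast_smul_eq_nsmul F, smul_smul]
    congr 1
    have : ((k + 1 : ℕ) : F) ≠ 0 := by exact_mod_cast k.succ_ne_zero
    rw [Nat.factorial_succ, Nat.cast_mul]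
    have := hfac k
    field_simp
  rw [hscale]
  rcases Nat.eq_zero_or_pos k with rfl | hk
  · simp only [zero_add, h1, h0, Finset.HasAntidiagonal.antidiagonal_zero,
      Finset.sum_singleton, Nat.factorial_zero, Nat.cast_one, inv_one, neg_smul, one_smul, neg_neg, if_true]
    noncomm_ring
  · set y : ℕ → R := fun m => -(m.factorial : F)⁻¹ • ε m with hy
    have hsum : -(k.factorial : F)⁻¹ • (2 : F)⁻¹ • ∑ m ∈ Finset.Ioo 0 k,
          ((k.factorial : F) / ((m.factorial : F) * ((k - m).factorial : F))) •
            (ε (k - m) * δ * ε m + ε m * δ * ε (k - m))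
        = -∑ m ∈ Finset.Ioo 0 k, y m * δ * y (k - m) := by
      have hrefl : ∑ m ∈ Finset.Ioo 0 k, y (k - m) * δ * y m
          = ∑ m ∈ Finset.Ioo 0 k, y m * δ * y (k - m) := by
        refine Finset.sum_bij' (fun m _ => k - m) (fun m _ => k - m) ?_ ?_ ?_ ?_ ?_
        all_goals intro m hm
        all_goals rw [Finset.mem_Ioo] at hm
        · rw [Finset.mem_Ioo]; omega
        · rw [Finset.mem_Ioo]; omega
        · omega
        · omega
        · rw [show k - (k - m) = m by omega]
      have hterm : ∀ m, (k.factorial : F)⁻¹ •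
          ((k.factorial : F) / ((m.factorial : F) * ((k - m).factorial : F))) •
            (ε (k - m) * δ * ε m + ε m * δ * ε (k - m))
          = y (k - m) * δ * y m + y m * δ * y (k - m) := by
        intro m
        simp only [hy, neg_smul, neg_mul, mul_neg, smul_neg, neg_neg, smul_mul_assoc,
          mul_smul_comm, smul_smul, smul_add]
        have := hfac k
        have := hfac m
        have := hfac (k - m)
        congr 2 <;> field_simp
      rw [smul_comm, neg_smul, Finset.smul_sum, Finset.sum_congr rfl fun m _ => hterm m,
        Finset.sum_add_distrib, hrefl, ← two_smul F, smul_neg, smul_smul,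
        inv_mul_cancel₀ (two_ne_zero' F), one_smul]
    rw [hε k hk, if_neg hk.ne', Finset.sum_antidiagonal_eq_ends_add_Ioo
      (fun i j => y i * δ * y j) hk, smul_add, hsum]
    have hy0 : y 0 = x₀ := by simp [hy, h0]
    have hyk : -(k.factorial : F)⁻¹ • ε k = y k := rfl
    have hleft : ∀ r, -(k.factorial : F)⁻¹ • (r * ε k) = r * y k := fun r =>
      (mul_smul_comm _ _ _).symm
    have hright : ∀ r, -(k.factorial : F)⁻¹ • (ε k * δ * r) = y k * δ * r := fun r => by
      rw [← smul_mul_assoc, ← smul_mul_assoc]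
    simp only [hy0, smul_add, smul_sub, hleft, hright, hyk]
    abel

section IdealFiltration

variable {S M N Q : Type*} [CommRing S] [AddCommGroup M] [Module S M] [AddCommGroup N] [Module S N]
  [AddCommGroup Q] [Module S Q]

theorem LinearMap.range_comp_le_pow_smul_top {I : Ideal S} {s t : ℕ} {f : N →ₗ[S] Q}
    {g : M →ₗ[S] N} (hf : range f ≤ I ^ s • (⊤ : Submodule S Q))
    (hg : range g ≤ I ^ t • (⊤ : Submodule S N)) :
    range (f ∘ₗ g) ≤ I ^ (s + t) • (⊤ : Submodule S Q) := by
  rw [range_comp, pow_add, mul_comm, Submodule.mul_smul]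
  refine (Submodule.map_mono hg).trans ?_
  rw [Submodule.map_smul'', Submodule.map_top]
  exact Submodule.smul_mono le_rfl hf

theorem LinearMap.range_comp_le_smul_top_of_left {I : Ideal S} {f : N →ₗ[S] Q}
    (hf : range f ≤ I • (⊤ : Submodule S Q)) (g : M →ₗ[S] N) :
    range (f ∘ₗ g) ≤ I • (⊤ : Submodule S Q) :=
  (range_comp_le_range g f).trans hf

theorem LinearMap.range_comp_le_smul_top_of_right {I : Ideal S} (f : N →ₗ[S] Q) {g : M →ₗ[S] N}
    (hg : range g ≤ I • (⊤ : Submodule S N)) :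
    range (f ∘ₗ g) ≤ I • (⊤ : Submodule S Q) := by
  have := range_comp_le_pow_smul_top (I := I) (s := 0) (t := 1) (f := f) (g := g) (by simp)
    (by simpa using hg)
  simpa using this

theorem LinearMap.range_pow_le_pow_smul_top {I : Ideal S} {f : Module.End S M}
    (hf : range f ≤ I • (⊤ : Submodule S M)) (k : ℕ) :
    range (f ^ k) ≤ I ^ k • (⊤ : Submodule S M) := by
  induction k with
  | zero => simp
  | succ k ih =>
    rw [pow_succ f]
    exact range_comp_le_pow_smul_top ih (by simpa using hf)

theorem LinearMap.eq_zero_of_range_le_pow_smul_top {I : Ideal S} {n k : ℕ} (hI : I ^ n = ⊥)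
    (hk : n ≤ k) {f : M →ₗ[S] N} (hf : range f ≤ I ^ k • (⊤ : Submodule S N)) : f = 0 := by
  have hIk : I ^ k = ⊥ := le_bot_iff.mp (hI ▸ Ideal.pow_le_pow_right hk)
  rwa [hIk, Submodule.bot_smul, le_bot_iff, range_eq_bot] at hf

theorem LinearMap.bijective_of_range_sub_one_le {I : Ideal S} {n : ℕ} (hI : I ^ n = ⊥)
    {f : Module.End S M} (hf : range (f - 1) ≤ I • (⊤ : Submodule S M)) :
    Function.Bijective f := by
  have hnil : IsNilpotent (f - 1) :=
    ⟨n, eq_zero_of_range_le_pow_smul_top hI le_rfl (range_pow_le_pow_smul_top hf n)⟩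
  have hunit : IsUnit f := by simpa using hnil.isUnit_one_add
  exact (Module.End.isUnit_iff f).mp hunit

end IdealFiltration

theorem mem_ker_smul_top_of_evMap_eq_zero {F S : Type} [Field F] [CommRing S] [Algebra F S]
    (ev : S →ₐ[F] F) {V : Type} [AddCommGroup V] [Module F V] {u : S ⊗[F] V}
    (hu : evMap F S ev V u = 0) :
    u ∈ RingHom.ker ev.toRingHom • (⊤ : Submodule S (S ⊗[F] V)) := by
  have key : ∀ w : S ⊗[F] V, w - (1 : S) ⊗ₜ[F] (evMap F S ev V w)
      ∈ RingHom.ker ev.toRingHom • (⊤ : Submodule S (S ⊗[F] V)) := by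
    intro w
    induction w with
    | zero => simp
    | tmul s v =>
      have hs : s ⊗ₜ[F] v - (1 : S) ⊗ₜ[F] (evMap F S ev V (s ⊗ₜ[F] v))
          = (s - algebraMap F S (ev s)) • ((1 : S) ⊗ₜ[F] v) := by
        simp [evMap, TensorProduct.smul_tmul', TensorProduct.tmul_smul,
          Algebra.algebraMap_eq_smul_one, TensorProduct.sub_tmul]
      rw [hs]
      exact Submodule.smul_mem_smul (by simp [RingHom.mem_ker]) trivial
    | add w₁ w₂ h₁ h₂ =>
      rw [map_add, TensorProduct.tmul_add, add_sub_add_comm]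
      exact add_mem h₁ h₂
  simpa [hu] using key u

/-- The terms of a Riccati recursion driven by an operator with values in `I M` decay
`I`-adically. -/
theorem range_le_of_riccati {F S M : Type*} [Field F] [CharZero F] [CommRing S] [Algebra F S]
    [AddCommGroup M] [Module S M] {I : Ideal S} {p q δ : Module.End S M}
    (hδ : LinearMap.range δ ≤ I • (⊤ : Submodule S M)) {x : ℕ → Module.End S M}
    (hx : ∀ k, (k + 1) • x (k + 1) = (if k = 0 then q * δ * p else 0) + q * δ * x k
      - x k * δ * p - ∑ s ∈ Finset.HasAntidiagonal.antidiagonal k, x s.1 * δ * x s.2) (k : ℕ) :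
    LinearMap.range (x k) ≤ I ^ k • (⊤ : Submodule S M) := by
  have mul_mem : ∀ {s t : ℕ} {f g : Module.End S M},
      LinearMap.range f ≤ I ^ s • (⊤ : Submodule S M) →
      LinearMap.range g ≤ I ^ t • (⊤ : Submodule S M) →
      LinearMap.range (f * g) ≤ I ^ (s + t) • (⊤ : Submodule S M) :=
    fun hf hg => LinearMap.range_comp_le_pow_smul_top hf hg
  have triv : ∀ f : Module.End S M, LinearMap.range f ≤ I ^ 0 • (⊤ : Submodule S M) := by simp
  have hδ' : LinearMap.range δ ≤ I ^ 1 • (⊤ : Submodule S M) := by simpa using hδ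
  induction k using Nat.strong_induction_on with
  | _ k ih =>
    cases k with
    | zero => exact triv _
    | succ k =>
      rintro _ ⟨v, rfl⟩
      have hmem : ((k + 1) • x (k + 1)) v ∈ I ^ (k + 1) • (⊤ : Submodule S M) := by
        rw [hx k]
        simp only [LinearMap.sub_apply, LinearMap.add_apply, LinearMap.sum_apply]
        refine sub_mem (sub_mem (add_mem ?_ ?_) ?_) (sum_mem fun s hs => ?_)
        · split_ifs with hk
          · subst hk
            exact mul_mem (mul_mem (triv q) hδ') (triv p) ⟨v, rfl⟩
          · simp
        · rw [show k + 1 = 0 + 1 + k by omega]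
          exact mul_mem (mul_mem (triv q) hδ') (ih k k.lt_succ_self) ⟨v, rfl⟩
        · exact mul_mem (mul_mem (ih k k.lt_succ_self) hδ') (triv p) ⟨v, rfl⟩
        · have hs' : s.1 + s.2 = k := by simpa using hs
          rw [show k + 1 = s.1 + 1 + s.2 by omega]
          exact mul_mem (mul_mem (ih s.1 (by omega)) hδ') (ih s.2 (by omega)) ⟨v, rfl⟩
      have hinv := Submodule.smul_mem _ (algebraMap F S ((k + 1 : ℕ) : F)⁻¹) hmem
      have hk : ((k + 1 : ℕ) : F) ≠ 0 := by exact_mod_cast k.succ_ne_zero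
      rwa [LinearMap.smul_apply, ← Nat.cast_smul_eq_nsmul S, smul_smul,
        ← map_natCast (algebraMap F S), ← map_mul, inv_mul_cancel₀ hk, map_one, one_smul] at hinv

theorem LinearMap.isAddTorsionFree_end {F S M : Type*} [Field F] [CharZero F] [CommRing S]
    [Algebra F S] [AddCommGroup M] [Module S M] : IsAddTorsionFree (Module.End S M) := by
  refine ⟨fun k hk f g hfg => ?_⟩
  have hk' : (k : F) ≠ 0 := by exact_mod_cast hk
  have h := congrArg (algebraMap F S (k : F)⁻¹ • ·) hfg
  simpa only [← Nat.cast_smul_eq_nsmul S, smul_smul, ← map_natCast (algebraMap F S), ← map_mul,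
    inv_mul_cancel₀ hk', map_one, one_smul] using h

theorem range_expEnd_sub_one_le {F S M : Type} [Field F] [CommRing S] [Algebra F S]
    [AddCommGroup M] [Module S M] {I : Ideal S} {δ : Module.End S M}
    (hδ : LinearMap.range δ ≤ I • (⊤ : Submodule S M)) (n : ℕ) :
    LinearMap.range (expEnd F (n + 1) δ - 1) ≤ I • (⊤ : Submodule S M) := by
  rintro _ ⟨v, rfl⟩
  rw [expEnd, Finset.sum_range_succ', pow_zero, Nat.factorial_zero, Nat.cast_one, inv_one, map_one,
    one_smul, add_sub_cancel_right, LinearMap.sum_apply]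
  refine sum_mem fun k _ => ?_
  rw [LinearMap.smul_apply, pow_succ' δ]
  exact Submodule.smul_mem _ _ (hδ ⟨_, rfl⟩)

section SplitModules

variable {S M N L : Type} [CommRing S] [AddCommGroup M] [Module S M] [AddCommGroup N] [Module S N]
  [AddCommGroup L] [Module S L]

/-- A map `X : M → N` viewed as the endomorphism `J ∘ X ∘ A` of `L`. -/
def extendEnd (J : N →ₗ[S] L) (A : L →ₗ[S] M) : (M →ₗ[S] N) →ₗ[S] Module.End S L where
  toFun X := J ∘ₗ X ∘ₗ A
  map_add' X Y := by ext; simp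
  map_smul' c X := by ext; simp

/-- The image of `I + J ∘ ξ` under `exp δ` lies in the graph of the gauge transform
`-∑ e k / k!` of `ξ`. -/
theorem prB_expEnd_eq_gauge_comp {F : Type} [Field F] [CharZero F] [Algebra F S] {n : ℕ}
    {𝔪 : Ideal S} (hnil : 𝔪 ^ (n + 1) = ⊥) {I : M →ₗ[S] L} {J : N →ₗ[S] L} {A : L →ₗ[S] M}
    {B : L →ₗ[S] N} (hAI : ∀ v, A (I v) = v) (hBJ : ∀ w, B (J w) = w) (hAJ : ∀ w, A (J w) = 0)
    (hBI : ∀ v, B (I v) = 0) (hsplit : ∀ u, I (A u) + J (B u) = u) {δ : Module.End S L}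
    (hδ : LinearMap.range δ ≤ 𝔪 • (⊤ : Submodule S L)) {ξ : M →ₗ[S] N} {e : ℕ → (M →ₗ[S] N)}
    (he0 : e 0 = -ξ)
    (he1 : e 1 = -(B ∘ₗ δ ∘ₗ (I + J ∘ₗ ξ)) + ξ ∘ₗ (A ∘ₗ δ ∘ₗ (I + J ∘ₗ ξ)))
    (he : ∀ k : ℕ, 1 ≤ k → e (k + 1) = (B ∘ₗ δ ∘ₗ J ∘ₗ e k - e k ∘ₗ A ∘ₗ δ ∘ₗ I)
      - (e k ∘ₗ A ∘ₗ δ ∘ₗ J ∘ₗ ξ + ξ ∘ₗ A ∘ₗ δ ∘ₗ J ∘ₗ e k)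
      + (algebraMap F S ((2 : F)⁻¹)) • ∑ p ∈ Finset.Ioo 0 k,
          (algebraMap F S ((k.factorial : F) / ((p.factorial : F) * ((k - p).factorial : F)))) •
            (e (k - p) ∘ₗ A ∘ₗ δ ∘ₗ J ∘ₗ e p + e p ∘ₗ A ∘ₗ δ ∘ₗ J ∘ₗ e (k - p))) :
    B ∘ₗ expEnd F (n + 1) δ ∘ₗ (I + J ∘ₗ ξ)
      = (-∑ k ∈ Finset.range (n + 1), (algebraMap F S ((k.factorial : F)⁻¹)) • e k)
          ∘ₗ A ∘ₗ expEnd F (n + 1) δ ∘ₗ (I + J ∘ₗ ξ) := by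
  let _ : Algebra F (Module.End S L) := Algebra.compHom _ (algebraMap F S)
  have : IsAddTorsionFree (Module.End S L) := LinearMap.isAddTorsionFree_end (F := F)
  have hsmul : ∀ (c : F) (f : Module.End S L), algebraMap F S c • f = c • f := fun _ _ => rfl
  set ζ := -∑ k ∈ Finset.range (n + 1), (algebraMap F S ((k.factorial : F)⁻¹)) • e k with hζ
  let p : Module.End S L := I ∘ₗ A
  let q : Module.End S L := J ∘ₗ B
  let x₀ := extendEnd J A ξ
  let ε : ℕ → Module.End S L := fun k => extendEnd J A (e k)
  let x : ℕ → Module.End S L := fun k => -(k.factorial : F)⁻¹ • ε k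
  let u : ℕ → Module.End S L := fun k => (k.factorial : F)⁻¹ • (δ ^ k * (p + x₀))
  have hpq : p + q = 1 := LinearMap.ext hsplit
  have hε0 : ε 0 = -x₀ := by simp only [ε, he0, map_neg, x₀]
  have hε1 : ε 1 = -((q - x₀) * δ * (p + x₀)) := by
    simp only [ε, he1, map_add, map_neg]
    rw [sub_mul, sub_mul, neg_sub, neg_add_eq_sub]
    rfl
  have hbr2 : ∀ X, extendEnd J A (B ∘ₗ δ ∘ₗ J ∘ₗ X - X ∘ₗ A ∘ₗ δ ∘ₗ I)
      = q * δ * extendEnd J A X - extendEnd J A X * δ * p := fun X => by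
    rw [map_sub]; rfl
  have hbr3 : ∀ X Y, extendEnd J A (Y ∘ₗ A ∘ₗ δ ∘ₗ J ∘ₗ X + X ∘ₗ A ∘ₗ δ ∘ₗ J ∘ₗ Y)
      = extendEnd J A Y * δ * extendEnd J A X + extendEnd J A X * δ * extendEnd J A Y :=
    fun X Y => by rw [map_add]; rfl
  have hx' := riccati_of_gauge_recursion (F := F) (p := p) (q := q) (δ := δ) hε0 hε1
    (fun k hk => by
      simp only [ε, he k hk, map_add _ (_ - _), map_sub _ (_ - _), map_smul, map_sum, hbr2, hbr3,
        hsmul, x₀])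
  have hxr := range_le_of_riccati (F := F) hδ (x := x) hx'
  have hur : ∀ k, n + 1 ≤ k → u k = 0 := fun k hk => by
    simp only [u]
    rw [LinearMap.eq_zero_of_range_le_pow_smul_top hnil hk
      (LinearMap.range_pow_le_pow_smul_top hδ k), zero_mul, smul_zero]
  have hu' : ∀ k, (k + 1) • u (k + 1) = δ * u k := by
    intro k
    have hk : ((k + 1 : ℕ) : F) ≠ 0 := by exact_mod_cast k.succ_ne_zero
    simp only [u]
    rw [← Nat.cast_smul_eq_nsmul F, smul_smul, Nat.factorial_succ, Nat.cast_mul, mul_inv,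
      mul_inv_cancel_left₀ hk, pow_succ' δ, mul_smul_comm, mul_assoc]
  have h0 : (q - x 0) * u 0 = 0 := by
    have hx0 : x 0 = x₀ := by simp [x, hε0]
    have hu0 : u 0 = p + x₀ := by simp [u]
    rw [hx0, hu0]
    ext v
    simp [p, q, x₀, extendEnd, hAI, hBJ, hAJ, hBI]
  have hmain := riccati_sum_mul_sum_eq_zero hpq
    (fun k hk => LinearMap.eq_zero_of_range_le_pow_smul_top hnil hk (hxr k)) hur hx' hu' h0
  have hxsum : ∑ k ∈ Finset.range (n + 1), x k = extendEnd J A ζ := by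
    simp only [x, ε, hζ, map_neg, map_sum, map_smul, hsmul, neg_smul, Finset.sum_neg_distrib]
  have husum : ∑ k ∈ Finset.range (n + 1), u k = expEnd F (n + 1) δ * (p + x₀) := by
    simp only [u, expEnd, Finset.sum_mul, hsmul, smul_mul_assoc]
  rw [hxsum, husum] at hmain
  refine LinearMap.ext fun v => ?_
  have hv := congrArg B (LinearMap.congr_fun hmain (I v))
  simp only [p, q, x₀, extendEnd, LinearMap.coe_mk, AddHom.coe_mk, Module.End.mul_apply,
    LinearMap.sub_apply, LinearMap.add_apply, LinearMap.comp_apply, LinearMap.zero_apply, map_sub,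
    map_zero, hAI, hBJ] at hv
  exact sub_eq_zero.mp hv

end SplitModules

/- STATEMENT 12: with Π_A := pr_a∘exp(δ)∘I_ξ, Π_A is bijective, and
η = e^δ ∗ ξ (gauge equivalence, i.e. η = −Σ_k e^k/k!)  ⟺
exp(δ)∘I_ξ = I_η∘Π_A (weak isomorphism of the standard deformations I_ξ, I_η). -/
theorem stmt_12
    {𝒜 : Type} [CommRing 𝒜] [Algebra K 𝒜] [CharZero K]
    (ev : 𝒜 →ₐ[K] K) (n : ℕ) (hnil : (RingHom.ker ev.toRingHom) ^ (n + 1) = ⊥)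
    (i : a →ₗ⁅K⁆ l) (hi : Function.Injective i)
    (j : b →ₗ[K] l) (prA : l →ₗ[K] a) (prB : l →ₗ[K] b)
    (hpi : ∀ x : a, prA (i x) = x) (hpj : ∀ w : b, prB (j w) = w)
    (hpaj : ∀ w : b, prA (j w) = 0) (hpbi : ∀ x : a, prB (i x) = 0)
    (hsplit : ∀ u : l, i (prA u) + j (prB u) = u)
    (ξ η : 𝒜 ⊗[K] a →ₗ[𝒜] 𝒜 ⊗[K] b)
    (hξm : ∀ x : 𝒜 ⊗[K] a, ξ x ∈ LinearMap.ker (evMap K 𝒜 ev b))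
    (hηm : ∀ x : 𝒜 ⊗[K] a, η x ∈ LinearMap.ker (evMap K 𝒜 ev b))
    (hstdξ : StdEq 𝒜 i j prA ξ) (hstdη : StdEq 𝒜 i j prA η)
    (δ : Module.End 𝒜 (𝒜 ⊗[K] l))
    (hder : ∀ u v : 𝒜 ⊗[K] l, δ ⁅u, v⁆ = ⁅δ u, v⁆ + ⁅u, δ v⁆)
    (hδm : ∀ u : 𝒜 ⊗[K] l, δ u ∈ LinearMap.ker (evMap K 𝒜 ev l)) :
    Function.Bijective
      ((LinearMap.baseChange 𝒜 prA) ∘ₗ (expEnd K (n + 1) δ) ∘ₗ IxiMap 𝒜 i j ξ) ∧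
    ∀ e : ℕ → (𝒜 ⊗[K] a →ₗ[𝒜] 𝒜 ⊗[K] b),
      e 0 = -ξ →
      e 1 = -((LinearMap.baseChange 𝒜 prB) ∘ₗ δ ∘ₗ IxiMap 𝒜 i j ξ)
          + ξ ∘ₗ ((LinearMap.baseChange 𝒜 prA) ∘ₗ δ ∘ₗ IxiMap 𝒜 i j ξ) →
      (∀ k : ℕ, 1 ≤ k →
        e (k + 1) = br2 𝒜 i j prA prB δ (e k) - br3 𝒜 j prA δ ξ (e k)
          + (algebraMap K 𝒜 ((2 : K)⁻¹)) •
              ∑ p ∈ Finset.Ioo 0 k,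
                (algebraMap K 𝒜
                    ((k.factorial : K) / ((p.factorial : K) * ((k - p).factorial : K)))) •
                  br3 𝒜 j prA δ (e p) (e (k - p))) →
      ((η = -∑ k ∈ Finset.range (n + 1),
            (algebraMap K 𝒜 ((k.factorial : K)⁻¹)) • e k) ↔
        (expEnd K (n + 1) δ) ∘ₗ IxiMap 𝒜 i j ξ
          = (IxiMap 𝒜 i j η) ∘ₗ
              ((LinearMap.baseChange 𝒜 prA) ∘ₗ (expEnd K (n + 1) δ) ∘ₗ IxiMap 𝒜 i j ξ)) := by
  have hδ : LinearMap.range δ ≤ RingHom.ker ev.toRingHom • (⊤ : Submodule 𝒜 (𝒜 ⊗[K] l)) := by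
    rintro _ ⟨x, rfl⟩
    exact mem_ker_smul_top_of_evMap_eq_zero ev (hδm x)
  have hAI : ∀ v, prA.baseChange 𝒜 (i.toLinearMap.baseChange 𝒜 v) = v := by
    refine LinearMap.congr_fun (f := prA.baseChange 𝒜 ∘ₗ i.toLinearMap.baseChange 𝒜)
      (g := LinearMap.id) ?_
    ext; simp [hpi]
  have hAJ : ∀ w, prA.baseChange 𝒜 (j.baseChange 𝒜 w) = 0 := by
    refine LinearMap.congr_fun (f := prA.baseChange 𝒜 ∘ₗ j.baseChange 𝒜) (g := 0) ?_
    ext; simp [hpaj]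
  have hBI : ∀ v, prB.baseChange 𝒜 (i.toLinearMap.baseChange 𝒜 v) = 0 := by
    refine LinearMap.congr_fun (f := prB.baseChange 𝒜 ∘ₗ i.toLinearMap.baseChange 𝒜) (g := 0) ?_
    ext; simp [hpbi]
  have hBJ : ∀ w, prB.baseChange 𝒜 (j.baseChange 𝒜 w) = w := by
    refine LinearMap.congr_fun (f := prB.baseChange 𝒜 ∘ₗ j.baseChange 𝒜) (g := LinearMap.id) ?_
    ext; simp [hpj]
  have hIJ : ∀ u, i.toLinearMap.baseChange 𝒜 (prA.baseChange 𝒜 u)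
      + j.baseChange 𝒜 (prB.baseChange 𝒜 u) = u := by
    refine LinearMap.congr_fun (f := i.toLinearMap.baseChange 𝒜 ∘ₗ prA.baseChange 𝒜
      + j.baseChange 𝒜 ∘ₗ prB.baseChange 𝒜) (g := LinearMap.id) ?_
    ext; simp [← TensorProduct.tmul_add, hsplit]
  have hbij : Function.Bijective
      ((LinearMap.baseChange 𝒜 prA) ∘ₗ (expEnd K (n + 1) δ) ∘ₗ IxiMap 𝒜 i j ξ) := by
    refine LinearMap.bijective_of_range_sub_one_le hnil ?_
    have hsub : prA.baseChange 𝒜 ∘ₗ expEnd K (n + 1) δ ∘ₗ IxiMap 𝒜 i j ξ - 1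
        = prA.baseChange 𝒜 ∘ₗ (expEnd K (n + 1) δ - 1) ∘ₗ IxiMap 𝒜 i j ξ := by
      refine LinearMap.ext fun v => ?_
      simp [IxiMap, hAI, hAJ]
    rw [hsub]
    exact LinearMap.range_comp_le_smul_top_of_right _
      (LinearMap.range_comp_le_smul_top_of_left (range_expEnd_sub_one_le hδ n) _)
  refine ⟨hbij, fun e he0 he1 he => ?_⟩
  have hgauge : prB.baseChange 𝒜 ∘ₗ expEnd K (n + 1) δ ∘ₗ IxiMap 𝒜 i j ξ
      = (-∑ k ∈ Finset.range (n + 1), (algebraMap K 𝒜 ((k.factorial : K)⁻¹)) • e k)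
          ∘ₗ prA.baseChange 𝒜 ∘ₗ expEnd K (n + 1) δ ∘ₗ IxiMap 𝒜 i j ξ :=
    prB_expEnd_eq_gauge_comp hnil hAI hBJ hAJ hBI hIJ hδ he0 he1 he
  constructor
  · intro h
    rw [← h] at hgauge
    refine LinearMap.ext fun v => ?_
    have hv := LinearMap.congr_fun hgauge v
    simp only [LinearMap.comp_apply, IxiMap, LinearMap.add_apply] at hv ⊢
    rw [← hv, hIJ]
  · intro h
    refine (LinearMap.cancel_right hbij.surjective).mp ?_
    rw [← hgauge, h]
    refine LinearMap.ext fun v => ?_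
    simp only [LinearMap.comp_apply, IxiMap, LinearMap.add_apply, map_add, hAI, hAJ, hBI, hBJ,
      zero_add, add_zero]
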